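/- If G is a GFERF word hyperbolic group and A, B are quasiconvex subgroups of G, then the double coset AB = {ab : a ∈ A, b ∈ B} is separable in G, i.e. closed in the profinite topology on G. -/

import Mathlib

open scoped Pointwise

/-- `S` is a finite symmetrized generating set of the group `G`. -/
def IsSymmGenSet {G : Type*} [Group G] (S : Set G) : Prop :=
  S.Finite ∧ S⁻¹ = S ∧ Subgroup.closure S = ⊤

/-- The word length of `g` with respect to the generating set `S`: the length of a
shortest word over `S` representing `g`. -/
noncomputable def wordLength {G : Type*} [Group G] (S : Set G) (g : G) : ℕ :=
  sInf {n : ℕ | ∃ f : Fin n → G, (∀ i, f i ∈ S) ∧ (List.ofFn f).prod = g}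

/-- The left-invariant word metric `d(x,y) = |x⁻¹y|_G` on `G`. -/
noncomputable def wordDist {G : Type*} [Group G] (S : Set G) (x y : G) : ℕ :=
  wordLength S (x⁻¹ * y)

/-- The Gromov product `(x|y)_w = (d(x,w)+d(y,w)-d(x,y))/2`. -/
noncomputable def gromovProd {G : Type*} [Group G] (S : Set G) (x y w : G) : ℝ :=
  ((wordDist S w x : ℝ) + (wordDist S w y : ℝ) - (wordDist S x y : ℝ)) / 2

/-- A discrete geodesic from `u` to `v` in the Cayley graph `Γ(G,S)`: a sequence of
vertices `p 0 = u, ..., p (d(u,v)) = v` with `d(p i, p j) = j - i`. -/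
def IsGeodesic {G : Type*} [Group G] (S : Set G) (u v : G) (p : ℕ → G) : Prop :=
  p 0 = u ∧ p (wordDist S u v) = v ∧
    ∀ i j : ℕ, i ≤ j → j ≤ wordDist S u v → wordDist S (p i) (p j) = j - i

/-- A subset `Q ⊆ G` is `ε`-quasiconvex if every geodesic between two elements of `Q`
lies in the closed `ε`-neighborhood of `Q`. -/
def IsQuasiconvex {G : Type*} [Group G] (S : Set G) (ε : ℝ) (Q : Set G) : Prop :=
  ∀ u ∈ Q, ∀ v ∈ Q, ∀ p : ℕ → G, IsGeodesic S u v p →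
    ∀ i ≤ wordDist S u v, ∃ q ∈ Q, (wordDist S (p i) q : ℝ) ≤ ε

/-- All geodesic triangles in `Γ(G,S)` are `δ`-thin: two points on the sides of a
geodesic triangle, equidistant from a common vertex (within the Gromov product),
are at distance at most `δ` from each other. -/
def ThinTriangles {G : Type*} [Group G] (S : Set G) (δ : ℝ) : Prop :=
  ∀ a b c : G, ∀ p q : ℕ → G, IsGeodesic S a b p → IsGeodesic S a c q →
    ∀ i : ℕ, (i : ℝ) ≤ gromovProd S b c a → (wordDist S (p i) (q i) : ℝ) ≤ δ

/-- The profinite topology on `G`: cosets of finite index normal subgroups form a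
basis of open sets (equivalently, a basis of neighborhoods of the identity). -/
def profiniteTopology (G : Type*) [Group G] : TopologicalSpace G :=
  TopologicalSpace.generateFrom
    {U : Set G | ∃ (g : G) (N : Subgroup G), N.Normal ∧ N.FiniteIndex ∧ U = g • (N : Set G)}

/-- A subset of `G` is separable if it is closed in the profinite topology on `G`. -/
def SeparableSubset (G : Type*) [Group G] (P : Set G) : Prop :=
  @IsClosed G (profiniteTopology G) P

/-- A word hyperbolic group `G` (with finite symmetrized generating set `S`) is GFERF
if every quasiconvex subgroup of `G` is separable. -/
def GFERF {G : Type*} [Group G] (S : Set G) : Prop :=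
  ∀ H : Subgroup G, (∃ ε : ℝ, 0 ≤ ε ∧ IsQuasiconvex S ε (H : Set G)) →
    SeparableSubset G (H : Set G)

/-- A `(λ,c)`-quasigeodesic path of length `n` in the Cayley graph `Γ(G,S)`:
consecutive vertices are adjacent and every subpath `p|_{[i,j]}` satisfies
`λ(j-i) - c ≤ d(p i, p j)`. -/
def IsQuasigeodesicOn {G : Type*} [Group G] (S : Set G) (lam c : ℝ) (p : ℕ → G) (n : ℕ) : Prop :=
  (∀ i < n, wordDist S (p i) (p (i + 1)) = 1) ∧
    ∀ i j : ℕ, i ≤ j → j ≤ n → lam * ((j : ℝ) - (i : ℝ)) - c ≤ (wordDist S (p i) (p j) : ℝ)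

lemma exists_list_of_mem_closure_of_inv_eq {G : Type*} [Group G] {T : Set G} (hT : T⁻¹ = T)
    {g : G} (hg : g ∈ Subgroup.closure T) : ∃ l : List G, (∀ x ∈ l, x ∈ T) ∧ l.prod = g := by
  refine Submonoid.exists_list_of_mem_closure ?_
  rwa [← Subgroup.mem_toSubmonoid, Subgroup.closure_toSubmonoid, hT, Set.union_self] at hg

section WordMetric

variable {G : Type*} [Group G] {S : Set G}

lemma wordLength_le_length (l : List G) (hl : ∀ x ∈ l, x ∈ S) :
    wordLength S l.prod ≤ l.length :=
  Nat.sInf_le ⟨l.get, fun i => hl _ (l.get_mem i), by rw [List.ofFn_get]⟩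

lemma exists_list_wordLength (hS : IsSymmGenSet S) (g : G) :
    ∃ l : List G, (∀ x ∈ l, x ∈ S) ∧ l.prod = g ∧ l.length = wordLength S g := by
  have hne : {n : ℕ | ∃ f : Fin n → G, (∀ i, f i ∈ S) ∧ (List.ofFn f).prod = g}.Nonempty := by
    have hg : g ∈ Subgroup.closure S := by rw [hS.2.2]; trivial
    obtain ⟨l, hl, rfl⟩ := exists_list_of_mem_closure_of_inv_eq hS.2.1 hg
    exact ⟨l.length, l.get, fun i => hl _ (l.get_mem i), by rw [List.ofFn_get]⟩
  obtain ⟨f, hf, hfg⟩ := Nat.sInf_mem hne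
  refine ⟨List.ofFn f, fun x hx => ?_, hfg, by rw [List.length_ofFn]; rfl⟩
  obtain ⟨i, rfl⟩ := (List.mem_ofFn' f x).1 hx
  exact hf i

lemma wordLength_mul_le (hS : IsSymmGenSet S) (g h : G) :
    wordLength S (g * h) ≤ wordLength S g + wordLength S h := by
  obtain ⟨l, hl, rfl, hlen⟩ := exists_list_wordLength hS g
  obtain ⟨m, hm, rfl, hmen⟩ := exists_list_wordLength hS h
  rw [← hlen, ← hmen, ← List.prod_append, ← List.length_append]
  refine wordLength_le_length _ fun x hx => ?_
  rcases List.mem_append.1 hx with h | h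
  exacts [hl x h, hm x h]

lemma wordLength_one : wordLength S (1 : G) = 0 :=
  Nat.le_zero.1 (wordLength_le_length (S := S) [] (by simp))

lemma wordLength_inv_le (hS : IsSymmGenSet S) (g : G) :
    wordLength S g⁻¹ ≤ wordLength S g := by
  obtain ⟨l, hl, rfl, hlen⟩ := exists_list_wordLength hS g
  rw [← hlen, List.prod_inv_reverse]
  refine (wordLength_le_length _ fun x hx => ?_).trans (by simp)
  rw [List.mem_reverse, List.mem_map] at hx
  obtain ⟨y, hy, rfl⟩ := hx
  rw [← hS.2.1]
  exact Set.inv_mem_inv.2 (hl y hy)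

lemma wordLength_inv (hS : IsSymmGenSet S) (g : G) :
    wordLength S g⁻¹ = wordLength S g :=
  le_antisymm (wordLength_inv_le hS g) (by simpa using wordLength_inv_le hS g⁻¹)

lemma wordDist_self (x : G) : wordDist S x x = 0 := by
  simp [wordDist, wordLength_one]

lemma wordDist_comm (hS : IsSymmGenSet S) (x y : G) : wordDist S x y = wordDist S y x := by
  rw [wordDist, ← wordLength_inv hS]; simp [wordDist]

lemma wordDist_triangle (hS : IsSymmGenSet S) (x y z : G) :
    wordDist S x z ≤ wordDist S x y + wordDist S y z := by
  simpa [wordDist, mul_assoc] using wordLength_mul_le hS (x⁻¹ * y) (y⁻¹ * z)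

lemma wordDist_mul_left (g x y : G) : wordDist S (g * x) (g * y) = wordDist S x y := by
  simp [wordDist, mul_assoc]

lemma wordDist_one_left (g : G) : wordDist S 1 g = wordLength S g := by
  simp [wordDist]

lemma wordDist_mul_right (g h : G) : wordDist S g (g * h) = wordLength S h := by
  simp [wordDist]

lemma finite_wordLength_le (hS : IsSymmGenSet S) (n : ℕ) :
    {g : G | wordLength S g ≤ n}.Finite := by
  have : Finite S := hS.1
  refine ((Set.finite_Iic n).biUnion fun k _ => Set.finite_range
    fun f : Fin k → S => (List.ofFn fun i => (f i : G)).prod).subset fun g hg => ?_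
  obtain ⟨l, hl, rfl, hlen⟩ := exists_list_wordLength hS g
  refine Set.mem_biUnion (x := l.length) (by rw [hlen]; exact hg)
    ⟨fun i => ⟨l.get i, hl _ (l.get_mem i)⟩, by simp only [List.ofFn_get]⟩

lemma exists_isGeodesic (hS : IsSymmGenSet S) (u v : G) : ∃ p, IsGeodesic S u v p := by
  obtain ⟨l, hl, hprod, hlen⟩ := exists_list_wordLength hS (u⁻¹ * v)
  have hle : ∀ i j, i ≤ j → wordDist S (u * (l.take i).prod) (u * (l.take j).prod) ≤ j - i := by
    intro i j hij
    have hsplit : l.take j = l.take i ++ (l.drop i).take (j - i) := by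
      rw [← List.take_add, Nat.add_sub_cancel' hij]
    rw [wordDist_mul_left, hsplit, List.prod_append, wordDist_mul_right]
    refine (wordLength_le_length _ fun x hx => ?_).trans (by simp)
    exact hl x (List.mem_of_mem_drop (List.mem_of_mem_take hx))
  have hend : u * (l.take (wordDist S u v)).prod = v := by
    rw [wordDist, ← hlen, List.take_length, hprod, mul_inv_cancel_left]
  refine ⟨fun i => u * (l.take i).prod, by simp, hend, fun i j hij hj => ?_⟩
  have h1 := hle 0 i (Nat.zero_le _)
  have h2 := hle i j hij
  have h3 := hle j _ hj
  rw [hend] at h3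
  simp only [List.take_zero, List.prod_nil, mul_one] at h1
  have h4 := wordDist_triangle hS u (u * (l.take i).prod) v
  have h5 := wordDist_triangle hS (u * (l.take i).prod) (u * (l.take j).prod) v
  dsimp only
  omega

lemma IsGeodesic.reverse (hS : IsSymmGenSet S) {u v : G} {p : ℕ → G} (hp : IsGeodesic S u v p) :
    IsGeodesic S v u fun i => p (wordDist S u v - i) := by
  obtain ⟨h0, h1, h2⟩ := hp
  refine ⟨by simpa using h1, by simpa [wordDist_comm hS v u] using h0, fun i j hij hj => ?_⟩
  rw [wordDist_comm hS v u] at hj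
  dsimp only
  rw [wordDist_comm hS, h2 _ _ (by omega) (by omega)]
  omega

lemma IsGeodesic.mul_left {u v : G} {p : ℕ → G} (hp : IsGeodesic S u v p) (g : G) :
    IsGeodesic S (g * u) (g * v) fun i => g * p i := by
  obtain ⟨h0, h1, h2⟩ := hp
  refine ⟨by simp [h0], by simp [wordDist_mul_left, h1], fun i j hij hj => ?_⟩
  rw [wordDist_mul_left] at hj ⊢
  exact h2 i j hij hj

lemma IsGeodesic.dist_right {u v : G} {p : ℕ → G} (hp : IsGeodesic S u v p) {i : ℕ}
    (hi : i ≤ wordDist S u v) : wordDist S (p i) v = wordDist S u v - i := by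
  simpa [hp.2.1] using hp.2.2 i _ hi le_rfl

/-- Thin triangles with an integral constant, with the Gromov product cleared of fractions. -/
def NatThin (S : Set G) (D : ℕ) : Prop :=
  ∀ a b c : G, ∀ p q : ℕ → G, IsGeodesic S a b p → IsGeodesic S a c q →
    ∀ i : ℕ, 2 * i + wordDist S b c ≤ wordDist S a b + wordDist S a c →
      wordDist S (p i) (q i) ≤ D

lemma ThinTriangles.exists_natThin {δ : ℝ} (h : ThinTriangles S δ) : ∃ D, NatThin S D := by
  refine ⟨⌈δ⌉₊, fun a b c p q hp hq i hi => ?_⟩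
  have hi' : (2 * i + wordDist S b c : ℝ) ≤ wordDist S a b + wordDist S a c := by exact_mod_cast hi
  have := h a b c p q hp hq i (by rw [gromovProd]; linarith)
  exact_mod_cast this.trans (Nat.le_ceil δ)

/-- Quasiconvexity with an integral constant. -/
def NatQuasiconvex (S : Set G) (e : ℕ) (Q : Set G) : Prop :=
  ∀ u ∈ Q, ∀ v ∈ Q, ∀ p : ℕ → G, IsGeodesic S u v p →
    ∀ i ≤ wordDist S u v, ∃ q ∈ Q, wordDist S (p i) q ≤ e

lemma IsQuasiconvex.exists_nat {ε : ℝ} {Q : Set G} (h : IsQuasiconvex S ε Q) :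
    ∃ e, NatQuasiconvex S e Q := by
  refine ⟨⌈ε⌉₊, fun u hu v hv p hp i hi => ?_⟩
  obtain ⟨q, hq, hd⟩ := h u hu v hv p hp i hi
  exact ⟨q, hq, by exact_mod_cast hd.trans (Nat.le_ceil ε)⟩

lemma NatQuasiconvex.isQuasiconvex {e : ℕ} {Q : Set G} (h : NatQuasiconvex S e Q) :
    IsQuasiconvex S e Q := by
  intro u hu v hv p hp i hi
  obtain ⟨q, hq, hd⟩ := h u hu v hv p hp i hi
  exact ⟨q, hq, by exact_mod_cast hd⟩

lemma NatQuasiconvex.mono {e e' : ℕ} {Q : Set G} (h : NatQuasiconvex S e Q) (he : e ≤ e') :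
    NatQuasiconvex S e' Q := by
  intro u hu v hv p hp i hi
  obtain ⟨q, hq, hd⟩ := h u hu v hv p hp i hi
  exact ⟨q, hq, hd.trans he⟩

/-- For a subgroup, quasiconvexity may be tested on geodesics issuing from the identity. -/
lemma natQuasiconvex_of_one {e : ℕ} {H : Subgroup G}
    (h : ∀ v ∈ H, ∀ p : ℕ → G, IsGeodesic S 1 v p →
      ∀ i ≤ wordDist S 1 v, ∃ q ∈ H, wordDist S (p i) q ≤ e) :
    NatQuasiconvex S e (H : Set G) := by
  intro u hu v hv p hp i hi
  have hp' := hp.mul_left u⁻¹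
  rw [inv_mul_cancel] at hp'
  obtain ⟨q, hq, hd⟩ := h (u⁻¹ * v) (H.mul_mem (H.inv_mem hu) hv) _ hp' i
    (by simpa [wordDist] using hi)
  refine ⟨u * q, H.mul_mem hu hq, ?_⟩
  rw [← wordDist_mul_left u] at hd
  simpa using hd

lemma four_point (hS : IsSymmGenSet S) {D : ℕ} (hD : NatThin S D) (w x y z : G) :
    wordDist S x z + wordDist S w y ≤ wordDist S x y + wordDist S w z + (2 * D + 1) ∨
    wordDist S x z + wordDist S w y ≤ wordDist S y z + wordDist S w x + (2 * D + 1) := by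
  obtain ⟨p, hp⟩ := exists_isGeodesic hS w x
  obtain ⟨q, hq⟩ := exists_isGeodesic hS w y
  obtain ⟨r, hr⟩ := exists_isGeodesic hS w z
  set t := min (wordDist S w x + wordDist S w y - wordDist S x y)
    (wordDist S w y + wordDist S w z - wordDist S y z) / 2 with ht
  have t1 := wordDist_triangle hS x w y
  have t2 := wordDist_triangle hS y w z
  have t3 := wordDist_triangle hS w x y
  have t4 := wordDist_triangle hS w y x
  have t5 := wordDist_triangle hS w z y
  have t6 := wordDist_triangle hS w y z
  rw [wordDist_comm hS x w] at t1
  rw [wordDist_comm hS y w] at t2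
  rw [wordDist_comm hS y x] at t4
  rw [wordDist_comm hS z y] at t5
  have h1 := hD w x y p q hp hq t (by omega)
  have h2 := hD w y z q r hq hr t (by omega)
  have h3 := hp.dist_right (i := t) (by omega)
  have h4 := hr.dist_right (i := t) (by omega)
  have h5 := wordDist_triangle hS x (p t) z
  have h6 := wordDist_triangle hS (p t) (q t) z
  have h7 := wordDist_triangle hS (q t) (r t) z
  rw [wordDist_comm hS x (p t)] at h5
  omega

end WordMetric

section Chain

variable {X : Type*} {d : X → X → ℕ} {E k N n : ℕ} {x : ℕ → X}

/-- A discrete broken line `x 0, …, x n` whose Gromov products at the corners are at most `k / 2`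
and whose segments, apart from the first and the last, have length at least `N`. -/
def IsBrokenLine (d : X → X → ℕ) (k N n : ℕ) (x : ℕ → X) : Prop :=
  (∀ i, i + 2 ≤ n → d (x (i + 1)) (x i) + d (x (i + 1)) (x (i + 2)) ≤ d (x i) (x (i + 2)) + k) ∧
    ∀ i, 1 ≤ i → i + 2 ≤ n → N ≤ d (x i) (x (i + 1))

lemma IsBrokenLine.reverse (hsymm : ∀ x y, d x y = d y x) (h : IsBrokenLine d k N n x) :
    IsBrokenLine d k N n fun i => x (n - i) := by
  refine ⟨fun i hi => ?_, fun i h1 hi => ?_⟩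
  · have := h.1 (n - (i + 2)) (by omega)
    rw [show n - (i + 2) + 1 = n - (i + 1) by omega, show n - (i + 2) + 2 = n - i by omega,
      hsymm (x (n - (i + 2))) (x (n - i))] at this
    dsimp only
    omega
  · have := h.2 (n - (i + 1)) (by omega) (by omega)
    rw [show n - (i + 1) + 1 = n - i by omega, hsymm] at this
    exact this

lemma IsBrokenLine.gromov_start (hsymm : ∀ x y, d x y = d y x)
    (h4 : ∀ w x y z, d x z + d w y ≤ d x y + d w z + E ∨ d x z + d w y ≤ d y z + d w x + E)
    (h : IsBrokenLine d k N n x) (hN : k + E < N) (i : ℕ) (hi : i + 2 ≤ n) :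
    d (x (i + 1)) (x 0) + d (x (i + 1)) (x (i + 2)) ≤ d (x 0) (x (i + 2)) + k + E := by
  induction i with
  | zero => have := h.1 0 hi; simp only [Nat.zero_add] at *; omega
  | succ i ih =>
    have h1 := ih (by omega)
    have h2 := h.1 (i + 1) hi
    have h3 := h.2 (i + 1) (by omega) (by omega)
    have h5 := h4 (x (i + 2)) (x (i + 1)) (x 0) (x (i + 3))
    have h6 := hsymm (x (i + 1)) (x (i + 2))
    have h7 := hsymm (x 0) (x (i + 2))
    simp only [Nat.add_assoc, Nat.reduceAdd] at *
    omega

lemma IsBrokenLine.gromov_ends (hsymm : ∀ x y, d x y = d y x) (hself : ∀ x, d x x = 0)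
    (h4 : ∀ w x y z, d x z + d w y ≤ d x y + d w z + E ∨ d x z + d w y ≤ d y z + d w x + E)
    (h : IsBrokenLine d k N n x) (hN : k + 2 * E < N) (i : ℕ) (hi : i ≤ n) :
    d (x i) (x 0) + d (x i) (x n) ≤ d (x 0) (x n) + (k + 2 * E) := by
  rcases i with _ | i
  · simp [hself]
  rcases hi.eq_or_lt with hi' | hi'
  · rw [hi', hself, hsymm (x n)]; omega
  have hback := (h.reverse hsymm).gromov_start hsymm h4 (by omega) (n - (i + 2)) (by omega)
  simp only [Nat.sub_zero, show n - (n - (i + 2) + 1) = i + 1 by omega,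
    show n - (n - (i + 2) + 2) = i by omega] at hback
  have h7 := hsymm (x n) (x i)
  rcases i with _ | i
  · simp only [Nat.zero_add] at *; omega
  have h1 := h.gromov_start hsymm h4 (by omega) i (by omega)
  have h3 := h.2 (i + 1) (by omega) (by omega)
  have h5 := h4 (x (i + 2)) (x (i + 1)) (x 0) (x n)
  have h6 := hsymm (x (i + 1)) (x (i + 2))
  have h8 := hsymm (x 0) (x (i + 2))
  simp only [Nat.add_assoc, Nat.reduceAdd] at *
  omega

lemma IsBrokenLine.le_dist_ends (hsymm : ∀ x y, d x y = d y x)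
    (h4 : ∀ w x y z, d x z + d w y ≤ d x y + d w z + E ∨ d x z + d w y ≤ d y z + d w x + E)
    (h : IsBrokenLine d k N n x) (hN : k + E < N) (hn : 3 ≤ n) :
    N ≤ d (x 0) (x n) + 2 * (k + E) := by
  obtain ⟨n, rfl⟩ := Nat.exists_eq_add_of_le' hn
  have h1 := h.gromov_start hsymm h4 hN n (by omega)
  have h2 := h.gromov_start hsymm h4 hN (n + 1) (by omega)
  have h3 := h.2 (n + 1) (by omega) (by omega)
  have h5 := hsymm (x (n + 2)) (x 0)
  simp only [Nat.add_assoc, Nat.reduceAdd] at *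
  omega

end Chain

section Hyperbolic

variable {G : Type*} [Group G] {S : Set G} {D k N n : ℕ} {x : ℕ → G}

/-- A geodesic joining the ends of a broken line stays close to the segments of that line. -/
lemma IsBrokenLine.geodesic_near (hS : IsSymmGenSet S) (hD : NatThin S D)
    (h : IsBrokenLine (wordDist S) k N n x) (hN : k + 2 * (2 * D + 1) < N) (hn : 0 < n)
    {p : ℕ → G} (hp : IsGeodesic S (x 0) (x n) p) {t : ℕ} (ht : t ≤ wordDist S (x 0) (x n)) :
    ∃ i < n, ∃ r, IsGeodesic S (x i) (x (i + 1)) r ∧ ∃ j ≤ wordDist S (x i) (x (i + 1)),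
      wordDist S (p t) (r j) ≤ 2 * (k + 2 * (2 * D + 1)) + 2 * D := by
  obtain ⟨i, hin, hi1, hi2⟩ : ∃ i < n, wordDist S (x 0) (x i) ≤ t ∧
      t ≤ wordDist S (x 0) (x (i + 1)) := by
    by_contra! hcon
    have hlt : ∀ i, i + 1 ≤ n → wordDist S (x 0) (x (i + 1)) < t := by
      intro i
      induction i with
      | zero => intro h1; exact hcon 0 h1 (by rw [wordDist_self]; omega)
      | succ i ih => intro h1; exact hcon (i + 1) h1 (ih (by omega)).le
    have := hlt (n - 1) (by omega)
    rw [Nat.sub_add_cancel hn] at this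
    omega
  obtain ⟨q, hq⟩ := exists_isGeodesic hS (x 0) (x (i + 1))
  obtain ⟨r, hr⟩ := exists_isGeodesic hS (x i) (x (i + 1))
  have hends := h.gromov_ends (wordDist_comm hS) wordDist_self (four_point hS hD) hN (i + 1) hin
  have c1 := wordDist_comm hS (x (i + 1)) (x 0)
  have c2 := wordDist_comm hS (x (i + 1)) (x i)
  have c3 := wordDist_comm hS (x i) (x 0)
  have t1 := wordDist_triangle hS (x (i + 1)) (x 0) (x n)
  have t2 := wordDist_triangle hS (x 0) (x i) (x (i + 1))
  set s := k + 2 * (2 * D + 1)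
  have h1 := hD _ _ _ q p hq hp (t - s) (by omega)
  have h2 := hq.2.2 (t - s) t (by omega) hi2
  have h3 := hp.2.2 (t - s) t (by omega) ht
  set L := wordDist S (x 0) (x (i + 1))
  set M := wordDist S (x i) (x (i + 1))
  have h4 : wordDist S (q t) (r (M - (L - t))) ≤ D := by
    have := hD _ _ _ _ _ (hq.reverse hS) (hr.reverse hS) (L - t) (by omega)
    rwa [show wordDist S (x 0) (x (i + 1)) - (L - t) = t by omega] at this
  refine ⟨i, hin, r, hr, M - (L - t), by omega, ?_⟩
  have t3 := wordDist_triangle hS (p t) (p (t - s)) (r (M - (L - t)))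
  have t4 := wordDist_triangle hS (p (t - s)) (q (t - s)) (r (M - (L - t)))
  have t5 := wordDist_triangle hS (q (t - s)) (q t) (r (M - (L - t)))
  have c4 := wordDist_comm hS (p t) (p (t - s))
  have c5 := wordDist_comm hS (p (t - s)) (q (t - s))
  omega

/-- A point close to both `A` and `B` is close to `A ⊓ B`. -/
lemma exists_near_inf (hS : IsSymmGenSet S) (A B : Subgroup G) (m : ℕ) :
    ∃ M, ∀ z a b : G, a ∈ A → b ∈ B → wordDist S z a ≤ m → wordDist S z b ≤ m →
      ∃ c ∈ A ⊓ B, wordDist S z c ≤ M := by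
  classical
  have hfin := (finite_wordLength_le hS m).prod (finite_wordLength_le hS m)
  have hex : ∀ w : G × G, ∃ a₀ : G, (∃ a ∈ A, ∃ b ∈ B, a * w.1 = b * w.2) →
      a₀ ∈ A ∧ ∃ b₀ ∈ B, a₀ * w.1 = b₀ * w.2 := by
    intro w
    by_cases hw : ∃ a ∈ A, ∃ b ∈ B, a * w.1 = b * w.2
    · obtain ⟨a, ha, hb⟩ := hw
      exact ⟨a, fun _ => ⟨ha, hb⟩⟩
    · exact ⟨1, fun h => absurd h hw⟩
  choose f hf using hex
  obtain ⟨M, hM⟩ := (hfin.image fun w : G × G => wordLength S (f w * w.1)).bddAbove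
  refine ⟨M, fun z a b ha hb hza hzb => ?_⟩
  obtain ⟨ha₀, b₀, hb₀, heq⟩ := hf (a⁻¹ * z, b⁻¹ * z) ⟨a, ha, b, hb, by simp⟩
  set w : G × G := (a⁻¹ * z, b⁻¹ * z) with hw
  have hab : a * (f w)⁻¹ = b * b₀⁻¹ := by
    have h1 : f w = b₀ * (b⁻¹ * z) * (a⁻¹ * z)⁻¹ := eq_mul_inv_of_mul_eq heq
    rw [h1]; group
  refine ⟨a * (f w)⁻¹, ⟨A.mul_mem ha (A.inv_mem ha₀), ?_⟩, ?_⟩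
  · rw [hab]; exact B.mul_mem hb (B.inv_mem hb₀)
  · rw [wordDist_comm hS] at hza hzb ⊢
    have : wordDist S (a * (f w)⁻¹) z = wordLength S (f w * w.1) := by
      simp [wordDist, hw, mul_assoc]
    rw [this]
    exact hM ⟨w, ⟨hza, hzb⟩, rfl⟩

lemma NatQuasiconvex.inf (hS : IsSymmGenSet S) {A B : Subgroup G} {e : ℕ}
    (hA : NatQuasiconvex S e (A : Set G)) (hB : NatQuasiconvex S e (B : Set G)) :
    ∃ e', NatQuasiconvex S e' ((A ⊓ B : Subgroup G) : Set G) := by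
  obtain ⟨M, hM⟩ := exists_near_inf hS A B e
  refine ⟨M, fun u hu v hv p hp i hi => ?_⟩
  obtain ⟨a, ha, had⟩ := hA u hu.1 v hv.1 p hp i hi
  obtain ⟨b, hb, hbd⟩ := hB u hu.2 v hv.2 p hp i hi
  exact hM _ a b ha hb had hbd

/-- If the Gromov product of `x⁻¹` and `y` is large, then some element of `A ⊓ B` can be moved
across the product `x * y` so that the total length drops. -/
lemma exists_gromov_bound (hS : IsSymmGenSet S) (hD : NatThin S D) {A B : Subgroup G} {e : ℕ}
    (hA : NatQuasiconvex S e (A : Set G)) (hB : NatQuasiconvex S e (B : Set G)) :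
    ∃ k, ∀ x ∈ A, ∀ y ∈ B,
      (∀ c ∈ A ⊓ B, wordLength S x + wordLength S y ≤
        wordLength S (x * c) + wordLength S (c⁻¹ * y)) →
      wordLength S x + wordLength S y ≤ wordLength S (x * y) + k := by
  obtain ⟨M, hM⟩ := exists_near_inf hS A B (D + e)
  refine ⟨2 * M + D + 1, fun x hx y hy hmin => ?_⟩
  obtain ⟨p, hp⟩ := exists_isGeodesic hS 1 x⁻¹
  obtain ⟨q, hq⟩ := exists_isGeodesic hS 1 y
  have e1 : wordDist S 1 x⁻¹ = wordLength S x := by rw [wordDist_one_left, wordLength_inv hS]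
  have e2 : wordDist S 1 y = wordLength S y := wordDist_one_left y
  have e3 : wordDist S x⁻¹ y = wordLength S (x * y) := by simp [wordDist]
  set t := (wordLength S x + wordLength S y - wordLength S (x * y)) / 2 with ht
  have t1 := wordDist_triangle hS 1 x⁻¹ y
  have t2 := wordDist_triangle hS 1 y x⁻¹
  have t3 := wordLength_mul_le hS x y
  rw [wordDist_comm hS y] at t2
  have h1 := hD _ _ _ p q hp hq t (by omega)
  obtain ⟨a, ha, had⟩ := hA 1 A.one_mem x⁻¹ (A.inv_mem hx) p hp t (by omega)
  obtain ⟨b, hb, hbd⟩ := hB 1 B.one_mem y hy q hq t (by omega)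
  have t4 := wordDist_triangle hS (p t) (q t) b
  obtain ⟨c, hc, hcd⟩ := hM (p t) a b ha hb (by omega) (by omega)
  have h2 := hmin c hc
  have e4 : wordDist S x⁻¹ c = wordLength S (x * c) := by simp [wordDist]
  have e5 : wordDist S c y = wordLength S (c⁻¹ * y) := rfl
  have t5 := wordDist_triangle hS x⁻¹ (p t) c
  have t6 := wordDist_triangle hS c (p t) y
  have t7 := wordDist_triangle hS (p t) (q t) y
  have d1 := hp.dist_right (i := t) (by omega)
  have d2 := hq.dist_right (i := t) (by omega)
  have c1 := wordDist_comm hS x⁻¹ (p t)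
  have c2 := wordDist_comm hS c (p t)
  omega

end Hyperbolic

section Factorization

variable {G : Type*} [Group G] {S : Set G} {A B A₁ B₁ P Q : Subgroup G}

/-- The list ends with an element of `B₁`, and its other elements lie in `P` or `Q`. -/
def IsTailFactorization (P Q B₁ : Subgroup G) : List G → Prop
  | [] => False
  | [b] => b ∈ B₁
  | x :: y :: l => (x ∈ P ∨ x ∈ Q) ∧ IsTailFactorization P Q B₁ (y :: l)

/-- The list starts with an element of `A₁`, ends with an element of `B₁`, and the elements in
between lie in `P` or `Q`. -/
def IsFactorization (P Q A₁ B₁ : Subgroup G) : List G → Prop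
  | [] => False
  | a :: l => a ∈ A₁ ∧ IsTailFactorization P Q B₁ l

/-- The quantity minimized by a reduced factorization. -/
noncomputable def factorizationCost (S : Set G) (l : List G) : ℕ :=
  (l.map fun x => wordLength S x + 1).sum

/-- A factorization of least cost among all factorizations with the same product. -/
def IsReducedFactorization (S : Set G) (P Q A₁ B₁ : Subgroup G) (l : List G) : Prop :=
  IsFactorization P Q A₁ B₁ l ∧ ∀ l', IsFactorization P Q A₁ B₁ l' → l'.prod = l.prod →
    factorizationCost S l ≤ factorizationCost S l'

lemma exists_isReducedFactorization {l : List G} (hl : IsFactorization P Q A₁ B₁ l) :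
    ∃ l', IsReducedFactorization S P Q A₁ B₁ l' ∧ l'.prod = l.prod := by
  obtain ⟨m, ⟨hm, hprod⟩, hmin⟩ := (measure (factorizationCost S)).wf.has_min
    {l' | IsFactorization P Q A₁ B₁ l' ∧ l'.prod = l.prod} ⟨l, hl, rfl⟩
  exact ⟨m, ⟨hm, fun l' hl' h => not_lt.1 (hmin l' ⟨hl', h.trans hprod⟩)⟩, hprod⟩

lemma isTailFactorization_concat {l : List G} {b : G} (hl : ∀ x ∈ l, x ∈ P ∨ x ∈ Q)
    (hb : b ∈ B₁) : IsTailFactorization P Q B₁ (l ++ [b]) := by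
  induction l with
  | nil => exact hb
  | cons x l ih =>
    have := ih fun z hz => hl z (List.mem_cons_of_mem _ hz)
    cases l with
    | nil => exact ⟨hl x (by simp), this⟩
    | cons y l => exact ⟨hl x (by simp), this⟩

lemma IsTailFactorization.cons {x : G} {l : List G} (hx : x ∈ P ∨ x ∈ Q)
    (hl : IsTailFactorization P Q B₁ l) : IsTailFactorization P Q B₁ (x :: l) := by
  cases l with
  | nil => exact hl.elim
  | cons y l => exact ⟨hx, hl⟩

lemma IsTailFactorization.of_append {l m : List G} (hm : m ≠ [])
    (h : IsTailFactorization P Q B₁ (l ++ m)) : IsTailFactorization P Q B₁ m := by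
  induction l with
  | nil => exact h
  | cons x l ih =>
    rw [List.cons_append] at h
    obtain ⟨y, r, hr⟩ := List.exists_cons_of_ne_nil (l := l ++ m) (by simp [hm])
    refine ih ?_
    rw [hr] at h ⊢
    exact h.2

lemma IsTailFactorization.replace {l m m' : List G} (hm : m ≠ [])
    (h : IsTailFactorization P Q B₁ (l ++ m)) (hm' : IsTailFactorization P Q B₁ m') :
    IsTailFactorization P Q B₁ (l ++ m') := by
  induction l with
  | nil => exact hm'
  | cons x l ih =>
    rw [List.cons_append] at h ⊢
    obtain ⟨y, r, hr⟩ := List.exists_cons_of_ne_nil (l := l ++ m) (by simp [hm])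
    rw [hr] at h ih
    exact (ih h.2).cons h.1

lemma IsTailFactorization.mem_of_le {l : List G} (hB : B₁ ≤ Q)
    (h : IsTailFactorization P Q B₁ l) : ∀ x ∈ l, x ∈ P ∨ x ∈ Q := by
  induction l with
  | nil => exact h.elim
  | cons x l ih =>
    cases l with
    | nil => intro y hy; rw [List.mem_singleton.1 hy]; exact Or.inr (hB h)
    | cons z l =>
      intro y hy
      rcases List.mem_cons.1 hy with rfl | hy
      exacts [h.1, ih h.2 y hy]

lemma IsTailFactorization.head_smul {x y : G} {l : List G} (hxP : x ∈ P) (hxQ : x ∈ Q)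
    (hB : Q ≤ B₁) (h : IsTailFactorization P Q B₁ (y :: l)) :
    IsTailFactorization P Q B₁ ((x * y) :: l) := by
  cases l with
  | nil => exact B₁.mul_mem (hB hxQ) h
  | cons z l => exact ⟨h.1.imp (P.mul_mem hxP) (Q.mul_mem hxQ), h.2⟩

lemma factorizationCost_append (l m : List G) :
    factorizationCost S (l ++ m) = factorizationCost S l + factorizationCost S m := by
  simp [factorizationCost]

lemma factorizationCost_cons (x : G) (l : List G) :
    factorizationCost S (x :: l) = wordLength S x + 1 + factorizationCost S l := by
  simp [factorizationCost]

/-- In a reduced factorization, neighbours cannot be merged. -/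
lemma IsReducedFactorization.not_merge (hS : IsSymmGenSet S) {l₁ l₂ : List G} {x y : G}
    (h : IsReducedFactorization S P Q A₁ B₁ (l₁ ++ x :: y :: l₂)) :
    ¬ IsFactorization P Q A₁ B₁ (l₁ ++ (x * y) :: l₂) := by
  intro hl
  have h1 := h.2 _ hl (by simp [mul_assoc])
  have h2 := wordLength_mul_le hS x y
  simp only [factorizationCost_append, factorizationCost_cons] at h1
  omega

/-- In a reduced factorization, no element of `P ⊓ Q` can be moved across to lower the length. -/
lemma IsReducedFactorization.shift (hP : P ≤ A₁) (hQ : Q ≤ B₁) {l₁ l₂ : List G} {x y c : G}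
    (h : IsReducedFactorization S P Q A₁ B₁ (l₁ ++ x :: y :: l₂)) (hcP : c ∈ P) (hcQ : c ∈ Q) :
    wordLength S x + wordLength S y ≤ wordLength S (x * c) + wordLength S (c⁻¹ * y) := by
  have hl : IsFactorization P Q A₁ B₁ (l₁ ++ (x * c) :: (c⁻¹ * y) :: l₂) := by
    have h0 := h.1
    cases l₁ with
    | nil => exact ⟨A₁.mul_mem h0.1 (hP hcP), h0.2.head_smul (P.inv_mem hcP) (Q.inv_mem hcQ) hQ⟩
    | cons a l₁ =>
      have h1 : IsTailFactorization P Q B₁ (x :: y :: l₂) := h0.2.of_append (by simp)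
      refine ⟨h0.1, h0.2.replace (by simp) ⟨?_, h1.2.head_smul (P.inv_mem hcP) (Q.inv_mem hcQ) hQ⟩⟩
      exact h1.1.imp (fun hx => P.mul_mem hx hcP) (fun hx => Q.mul_mem hx hcQ)
  have h1 := h.2 _ hl (by simp [mul_assoc])
  simp only [factorizationCost_append, factorizationCost_cons] at h1
  omega

/-- In a reduced factorization, elements of `A` and `B` alternate. -/
lemma IsReducedFactorization.alternate (hS : IsSymmGenSet S) (hP : P ≤ A₁) (hQ : Q ≤ B₁)
    (hA : A₁ ≤ A) (hB : B₁ ≤ B) {l₁ l₂ : List G} {x y : G}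
    (h : IsReducedFactorization S P Q A₁ B₁ (l₁ ++ x :: y :: l₂)) :
    (x ∈ A ∧ y ∈ B) ∨ (x ∈ B ∧ y ∈ A) := by
  have h0 := h.1
  have hn := h.not_merge hS
  cases l₁ with
  | nil =>
    refine Or.inl ⟨hA h0.1, ?_⟩
    cases l₂ with
    | nil => exact hB h0.2
    | cons z l =>
      rcases h0.2.1 with hy | hy
      · exact (hn ⟨A₁.mul_mem h0.1 (hP hy), h0.2.2⟩).elim
      · exact hB (hQ hy)
  | cons a l₁ =>
    have h1 : IsTailFactorization P Q B₁ (x :: y :: l₂) := h0.2.of_append (by simp)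
    have hn' : ¬ IsTailFactorization P Q B₁ ((x * y) :: l₂) := fun ht =>
      hn ⟨h0.1, h0.2.replace (by simp) ht⟩
    cases l₂ with
    | nil =>
      rcases h1.1 with hx | hx
      · exact Or.inl ⟨hA (hP hx), hB h1.2⟩
      · exact (hn' (B₁.mul_mem (hQ hx) h1.2)).elim
    | cons z l =>
      rcases h1.1 with hx | hx <;> rcases h1.2.1 with hy | hy
      · exact (hn' ⟨Or.inl (P.mul_mem hx hy), h1.2.2⟩).elim
      · exact Or.inl ⟨hA (hP hx), hB (hQ hy)⟩
      · exact Or.inr ⟨hB (hQ hx), hA (hP hy)⟩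
      · exact (hn' ⟨Or.inr (Q.mul_mem hx hy), h1.2.2⟩).elim

/-- Interior elements of a reduced factorization lie in `P` or `Q` but not in both. -/
lemma IsReducedFactorization.interior (hS : IsSymmGenSet S) (hQ : Q ≤ B₁)
    {l₁ l₂ : List G} {x y : G} (hl₁ : l₁ ≠ [])
    (h : IsReducedFactorization S P Q A₁ B₁ (l₁ ++ x :: y :: l₂)) :
    (x ∈ P ∨ x ∈ Q) ∧ ¬ (x ∈ P ∧ x ∈ Q) := by
  obtain ⟨a, l₁, rfl⟩ := List.exists_cons_of_ne_nil hl₁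
  have h0 := h.1
  have h1 : IsTailFactorization P Q B₁ (x :: y :: l₂) := h0.2.of_append (by simp)
  exact ⟨h1.1, fun hx => h.not_merge hS
    ⟨h0.1, h0.2.replace (by simp) (h1.2.head_smul hx.1 hx.2 hQ)⟩⟩

lemma List.eq_take_append_pair {α : Type*} (l : List α) (i : ℕ) (hi : i + 2 ≤ l.length) :
    l = l.take i ++ l[i] :: l[i + 1] :: l.drop (i + 2) := by
  rw [List.getElem_cons_drop, List.getElem_cons_drop, List.take_append_drop]

lemma wordDist_take_prod (l : List G) (i : ℕ) (hi : i < l.length) :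
    wordDist S (l.take i).prod (l.take (i + 1)).prod = wordLength S l[i] := by
  rw [List.prod_take_succ l i hi, wordDist_mul_right]

/-- The partial products of a reduced factorization form a broken line. -/
lemma IsReducedFactorization.isBrokenLine (hS : IsSymmGenSet S) (hP : P ≤ A₁) (hQ : Q ≤ B₁)
    (hA : A₁ ≤ A) (hB : B₁ ≤ B) (hABP : A ⊓ B ≤ P) (hABQ : A ⊓ B ≤ Q) {k N : ℕ}
    (hk : ∀ x y, (x ∈ A ∧ y ∈ B) ∨ (x ∈ B ∧ y ∈ A) →
      (∀ c ∈ A ⊓ B, wordLength S x + wordLength S y ≤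
        wordLength S (x * c) + wordLength S (c⁻¹ * y)) →
      wordLength S x + wordLength S y ≤ wordLength S (x * y) + k)
    (hN : ∀ x, x ∈ P ∨ x ∈ Q → x ∉ A ⊓ B → N ≤ wordLength S x)
    {l : List G} (h : IsReducedFactorization S P Q A₁ B₁ l) :
    IsBrokenLine (wordDist S) k N l.length fun i => (l.take i).prod := by
  refine ⟨fun i hi => ?_, fun i h1 hi => ?_⟩
  · have hl := List.eq_take_append_pair l i hi
    rw [hl] at h
    have := hk _ _ (h.alternate hS hP hQ hA hB) fun c hc => h.shift hP hQ (hABP hc) (hABQ hc)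
    dsimp only
    rw [wordDist_comm hS, wordDist_take_prod l i (by omega),
      wordDist_take_prod l (i + 1) (by omega),
      List.prod_take_succ l (i + 1) (by omega), List.prod_take_succ l i (by omega), mul_assoc,
      wordDist_mul_right]
    exact this
  · have hl := List.eq_take_append_pair l i hi
    rw [hl] at h
    have hne : l.take i ≠ [] := by
      intro h0
      have := congrArg List.length h0
      simp only [List.length_take, List.length_nil] at this
      omega
    obtain ⟨hx, hnx⟩ := h.interior hS hQ hne
    rw [wordDist_take_prod l i (by omega)]
    exact hN _ hx fun hC => hnx ⟨hABP hC, hABQ hC⟩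

end Factorization

section Profinite

variable {G : Type*} [Group G]

lemma separableSubset_iff {P : Set G} : SeparableSubset G P ↔
    ∀ g ∉ P, ∃ N : Subgroup G, N.Normal ∧ N.FiniteIndex ∧ ∀ m ∈ N, g * m ∉ P := by
  let _ := profiniteTopology G
  change IsClosed P ↔ _
  rw [← isOpen_compl_iff]
  constructor
  · intro h
    have key : ∀ U : Set G, TopologicalSpace.GenerateOpen {U : Set G | ∃ (g : G) (N : Subgroup G),
        N.Normal ∧ N.FiniteIndex ∧ U = g • (N : Set G)} U → ∀ g ∈ U,
        ∃ N : Subgroup G, N.Normal ∧ N.FiniteIndex ∧ ∀ m ∈ N, g * m ∈ U := by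
      intro U hU
      induction hU with
      | basic U hU =>
        obtain ⟨g₀, N, hN, hN', rfl⟩ := hU
        intro g hg
        refine ⟨N, hN, hN', fun m hm => ?_⟩
        rw [Set.mem_smul_set_iff_inv_smul_mem, smul_eq_mul] at hg ⊢
        rw [← mul_assoc]
        exact N.mul_mem hg hm
      | univ => exact fun g _ => ⟨⊤, inferInstance, inferInstance, fun _ _ => trivial⟩
      | inter U V _ _ ihU ihV =>
        intro g hg
        obtain ⟨N, hN, hN', h1⟩ := ihU g hg.1
        obtain ⟨M, hM, hM', h2⟩ := ihV g hg.2
        exact ⟨N ⊓ M, inferInstance, inferInstance, fun m hm => ⟨h1 m hm.1, h2 m hm.2⟩⟩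
      | sUnion T _ ih =>
        rintro g ⟨U, hU, hg⟩
        obtain ⟨N, hN, hN', h1⟩ := ih U hU g hg
        exact ⟨N, hN, hN', fun m hm => ⟨U, hU, h1 m hm⟩⟩
    exact key _ h
  · intro h
    rw [isOpen_iff_forall_mem_open]
    intro g hg
    obtain ⟨N, hN, hN', h1⟩ := h g hg
    refine ⟨g • (N : Set G), ?_, TopologicalSpace.isOpen_generateFrom_of_mem ⟨g, N, hN, hN', rfl⟩,
      ⟨1, N.one_mem, by simp⟩⟩
    rintro _ ⟨m, hm, rfl⟩
    exact h1 m hm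

/-- Finitely many antitone conditions, each satisfied by some finite index normal subgroup, are
satisfied by a common one. -/
lemma exists_normal_finiteIndex_of_finite {ι : Type*} {I : Set ι} (hI : I.Finite)
    (p : ι → Subgroup G → Prop) (hp : ∀ i, ∀ M N, M ≤ N → p i N → p i M)
    (h : ∀ i ∈ I, ∃ N : Subgroup G, N.Normal ∧ N.FiniteIndex ∧ p i N) :
    ∃ N : Subgroup G, N.Normal ∧ N.FiniteIndex ∧ ∀ i ∈ I, p i N := by
  induction I, hI using Set.Finite.induction_on with
  | empty => exact ⟨⊤, inferInstance, inferInstance, by simp⟩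
  | @insert i I _ _ ih =>
    obtain ⟨N, hN, hN', h1⟩ := ih fun j hj => h j (Set.mem_insert_of_mem _ hj)
    obtain ⟨M, hM, hM', h2⟩ := h i (Set.mem_insert _ _)
    refine ⟨N ⊓ M, inferInstance, inferInstance, fun j hj => ?_⟩
    rcases hj with rfl | hj
    exacts [hp _ _ _ inf_le_right h2, hp _ _ _ inf_le_left (h1 j hj)]

/-- A separable subgroup `C` lies in a finite index subgroup which meets a given finite set
only in elements of `C`. -/
lemma exists_finiteIndex_of_separable {C : Subgroup G} (hC : SeparableSubset G (C : Set G))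
    {W : Set G} (hW : W.Finite) :
    ∃ K : Subgroup G, K.FiniteIndex ∧ C ≤ K ∧ ∀ w ∈ W, w ∈ K → w ∈ C := by
  obtain ⟨N, hN, hN', h⟩ := exists_normal_finiteIndex_of_finite hW
    (fun w N => w ∉ C → ∀ m ∈ N, w * m ∉ C) (fun w M N hMN h hw m hm => h hw m (hMN hm))
    (fun w _ => by
      by_cases hw : w ∈ C
      · exact ⟨⊤, inferInstance, inferInstance, fun h => absurd hw h⟩
      · obtain ⟨N, hN, hN', h⟩ := separableSubset_iff.1 hC w hw
        exact ⟨N, hN, hN', fun _ => h⟩)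
  refine ⟨C ⊔ N, Subgroup.finiteIndex_of_le le_sup_right, le_sup_left, fun w hw hwK => ?_⟩
  by_contra hwC
  obtain ⟨c, hc, m, hm, rfl⟩ := Subgroup.mem_sup_of_normal_right.1 hwK
  exact h _ hw hwC m⁻¹ (N.inv_mem hm) (by simpa using hc)

/-- For `K` of finite index, finitely many elements of `A` suffice to translate every element of
`A` on the right into `A ⊓ K`. -/
lemma exists_finite_transversal (A K : Subgroup G) [K.FiniteIndex] :
    ∃ F : Set G, F.Finite ∧ F ⊆ A ∧ ∀ a ∈ A, ∃ f ∈ F, a * f ∈ A ⊓ K := by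
  classical
  let s : G ⧸ K → G := fun q => if h : ∃ a ∈ A, (a : G ⧸ K) = q then h.choose else 1
  have hs : ∀ q, s q ∈ A := by
    intro q
    by_cases h : ∃ a ∈ A, (a : G ⧸ K) = q
    · simp only [s, dif_pos h]; exact h.choose_spec.1
    · simp only [s, dif_neg h]; exact A.one_mem
  refine ⟨Set.range s, Set.finite_range s, by rintro _ ⟨q, rfl⟩; exact hs q, fun a ha => ?_⟩
  refine ⟨_, ⟨((a⁻¹ : G) : G ⧸ K), rfl⟩, A.mul_mem ha (hs _), ?_⟩
  have h : ∃ b ∈ A, (b : G ⧸ K) = ((a⁻¹ : G) : G ⧸ K) := ⟨a⁻¹, A.inv_mem ha, rfl⟩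
  have h2 := QuotientGroup.eq.1 h.choose_spec.2.symm
  simp only [s, dif_pos h]
  simpa using h2

lemma NatQuasiconvex.inf_finiteIndex {S : Set G} (hS : IsSymmGenSet S) {A : Subgroup G} {e : ℕ}
    (hA : NatQuasiconvex S e (A : Set G)) (K : Subgroup G) [K.FiniteIndex] :
    ∃ e', NatQuasiconvex S e' ((A ⊓ K : Subgroup G) : Set G) := by
  obtain ⟨F, hF, -, h⟩ := exists_finite_transversal A K
  obtain ⟨M, hM⟩ := (hF.image (wordLength S)).bddAbove
  refine ⟨e + M, fun u hu v hv p hp i hi => ?_⟩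
  obtain ⟨a, ha, had⟩ := hA u hu.1 v hv.1 p hp i hi
  obtain ⟨f, hf, haf⟩ := h a ha
  refine ⟨a * f, haf, (wordDist_triangle hS _ a _).trans ?_⟩
  rw [wordDist_mul_right]
  exact add_le_add had (hM ⟨f, hf, rfl⟩)

end Profinite

lemma exists_list_of_mem_sup {G : Type*} [Group G] {P Q : Subgroup G} {g : G} (hg : g ∈ P ⊔ Q) :
    ∃ l : List G, (∀ x ∈ l, x ∈ P ∨ x ∈ Q) ∧ l.prod = g := by
  rw [Subgroup.sup_eq_closure] at hg
  exact exists_list_of_mem_closure_of_inv_eq (T := (P : Set G) ∪ Q) (by simp) hg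

/-- If all short elements of `P ≤ A` and `Q ≤ B` lie in `A ⊓ B`, and `A ⊓ B ≤ P ⊓ Q`, then the subgroup `P ⊔ Q` is quasiconvex. -/
lemma natQuasiconvex_sup {G : Type*} [Group G] {S : Set G} (hS : IsSymmGenSet S) {D : ℕ}
    (hD : NatThin S D) {A B P Q : Subgroup G} (hPA : P ≤ A) (hQB : Q ≤ B)
    (hABP : A ⊓ B ≤ P) (hABQ : A ⊓ B ≤ Q) {k N e : ℕ}
    (hk : ∀ x y, (x ∈ A ∧ y ∈ B) ∨ (x ∈ B ∧ y ∈ A) →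
      (∀ c ∈ A ⊓ B, wordLength S x + wordLength S y ≤
        wordLength S (x * c) + wordLength S (c⁻¹ * y)) →
      wordLength S x + wordLength S y ≤ wordLength S (x * y) + k)
    (hN : ∀ x, x ∈ P ∨ x ∈ Q → x ∉ A ⊓ B → N ≤ wordLength S x)
    (hkN : k + 2 * (2 * D + 1) < N)
    (hP : NatQuasiconvex S e (P : Set G)) (hQ : NatQuasiconvex S e (Q : Set G)) :
    NatQuasiconvex S (2 * (k + 2 * (2 * D + 1)) + 2 * D + e) ((P ⊔ Q : Subgroup G) : Set G) := by
  refine natQuasiconvex_of_one fun g hg p hp t ht => ?_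
  obtain ⟨xs, hxs, rfl⟩ := exists_list_of_mem_sup hg
  obtain ⟨l, hl, hprod⟩ := exists_isReducedFactorization (S := S) (A₁ := P) (B₁ := Q)
    (l := 1 :: (xs ++ [1])) ⟨P.one_mem, isTailFactorization_concat hxs Q.one_mem⟩
  have hprod' : l.prod = xs.prod := by simpa using hprod
  have hmem : ∀ x ∈ l, x ∈ P ∨ x ∈ Q := by
    have h0 := hl.1
    cases l with
    | nil => exact h0.elim
    | cons a l =>
      intro x hx
      rcases List.mem_cons.1 hx with rfl | hx
      exacts [Or.inl h0.1, h0.2.mem_of_le le_rfl x hx]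
  have hlen : 0 < l.length := by
    have h0 := hl.1
    cases l with
    | nil => exact h0.elim
    | cons a l => simp
  have hb := hl.isBrokenLine hS le_rfl le_rfl hPA hQB hABP hABQ hk hN
  rw [← hprod'] at hp ht
  obtain ⟨i, hi, r, hr, j, hj, hd⟩ := hb.geodesic_near hS hD hkN hlen (p := p) (t := t)
    (by simpa using hp) (by simpa using ht)
  have hy : (l.take i).prod ∈ P ⊔ Q := by
    refine Subgroup.list_prod_mem _ fun x hx => ?_
    rcases hmem x (List.mem_of_mem_take hx) with h | h
    exacts [Subgroup.mem_sup_left h, Subgroup.mem_sup_right h]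
  set y := (l.take i).prod
  have hr' := hr.mul_left y⁻¹
  have hstep : y⁻¹ * (l.take (i + 1)).prod = l[i] := by
    rw [List.prod_take_succ l i hi, inv_mul_cancel_left]
  rw [inv_mul_cancel, hstep] at hr'
  have hj' : j ≤ wordDist S 1 l[i] := by
    rw [wordDist_take_prod l i hi] at hj
    rwa [wordDist_one_left]
  obtain ⟨q, hq, hqd⟩ : ∃ q ∈ P ⊔ Q, wordDist S (y⁻¹ * r j) q ≤ e := by
    rcases hmem l[i] (List.getElem_mem hi) with h | h
    · obtain ⟨q, hq, hqd⟩ := hP 1 P.one_mem _ h _ hr' j hj'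
      exact ⟨q, Subgroup.mem_sup_left hq, hqd⟩
    · obtain ⟨q, hq, hqd⟩ := hQ 1 Q.one_mem _ h _ hr' j hj'
      exact ⟨q, Subgroup.mem_sup_right hq, hqd⟩
  refine ⟨y * q, Subgroup.mul_mem _ hy hq, (wordDist_triangle hS _ (r j) _).trans ?_⟩
  rw [← wordDist_mul_left y, mul_inv_cancel_left] at hqd
  omega

/-- A short element of `A * (P ⊔ Q) * B` lies in `A * B`. -/
lemma mem_mul_of_short {G : Type*} [Group G] {S : Set G} (hS : IsSymmGenSet S) {D : ℕ}
    (hD : NatThin S D) {A B P Q : Subgroup G} (hPA : P ≤ A) (hQB : Q ≤ B)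
    (hABP : A ⊓ B ≤ P) (hABQ : A ⊓ B ≤ Q) {k N : ℕ}
    (hk : ∀ x y, (x ∈ A ∧ y ∈ B) ∨ (x ∈ B ∧ y ∈ A) →
      (∀ c ∈ A ⊓ B, wordLength S x + wordLength S y ≤
        wordLength S (x * c) + wordLength S (c⁻¹ * y)) →
      wordLength S x + wordLength S y ≤ wordLength S (x * y) + k)
    (hN : ∀ x, x ∈ P ∨ x ∈ Q → x ∉ A ⊓ B → N ≤ wordLength S x)
    {a h b : G} (ha : a ∈ A) (hh : h ∈ P ⊔ Q) (hb : b ∈ B)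
    (hkN : wordLength S (a * h * b) + 2 * (k + (2 * D + 1)) < N) :
    a * h * b ∈ (A : Set G) * (B : Set G) := by
  obtain ⟨xs, hxs, rfl⟩ := exists_list_of_mem_sup hh
  obtain ⟨l, hl, hprod⟩ := exists_isReducedFactorization (S := S) (A₁ := A) (B₁ := B)
    (l := a :: (xs ++ [b])) ⟨ha, isTailFactorization_concat hxs hb⟩
  have hprod' : l.prod = a * xs.prod * b := by simpa [mul_assoc] using hprod
  have hbl := hl.isBrokenLine hS hPA hQB le_rfl le_rfl hABP hABQ hk hN
  by_cases hlen : 3 ≤ l.length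
  · have := hbl.le_dist_ends (wordDist_comm hS) (four_point hS hD) (by omega) hlen
    simp only [List.take_zero, List.prod_nil, List.take_length, wordDist_one_left, hprod'] at this
    omega
  · rw [← hprod']
    have h0 := hl.1
    match l, h0, hlen with
    | [x, y], h0, _ => exact ⟨x, h0.1, y, h0.2, by simp⟩
    | [x], h0, _ => exact h0.2.elim
    | x :: y :: z :: l, _, hlen => exact (hlen (by simp)).elim

/-- **Corollary.** If `G` is a GFERF word hyperbolic group and `A`, `B` are quasiconvex
subgroups, then the double coset `AB` is separable in `G`. -/
theorem double_coset_separable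
    {G : Type*} [Group G] (S : Set G) (hS : IsSymmGenSet S)
    (δ : ℝ) (hδ : 0 ≤ δ) (hhyp : ThinTriangles S δ) (hGFERF : GFERF S)
    (A B : Subgroup G)
    (hA : ∃ ε : ℝ, 0 ≤ ε ∧ IsQuasiconvex S ε (A : Set G))
    (hB : ∃ ε : ℝ, 0 ≤ ε ∧ IsQuasiconvex S ε (B : Set G)) :
    SeparableSubset G ((A : Set G) * (B : Set G)) := by
  obtain ⟨D, hD⟩ := hhyp.exists_natThin
  obtain ⟨ε₁, -, hA⟩ := hA
  obtain ⟨ε₂, -, hB⟩ := hB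
  obtain ⟨e₁, hA⟩ := hA.exists_nat
  obtain ⟨e₂, hB⟩ := hB.exists_nat
  replace hA := hA.mono (le_max_left e₁ e₂)
  replace hB := hB.mono (le_max_right e₁ e₂)
  obtain ⟨k, hk⟩ : ∃ k, ∀ x y, (x ∈ A ∧ y ∈ B) ∨ (x ∈ B ∧ y ∈ A) →
      (∀ c ∈ A ⊓ B, wordLength S x + wordLength S y ≤
        wordLength S (x * c) + wordLength S (c⁻¹ * y)) →
      wordLength S x + wordLength S y ≤ wordLength S (x * y) + k := by
    obtain ⟨k₁, hk₁⟩ := exists_gromov_bound hS hD hA hB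
    obtain ⟨k₂, hk₂⟩ := exists_gromov_bound hS hD hB hA
    refine ⟨max k₁ k₂, fun x y hxy hc => ?_⟩
    rcases hxy with ⟨hx, hy⟩ | ⟨hx, hy⟩
    · have := hk₁ x hx y hy hc
      omega
    · have := hk₂ x hx y hy (by rwa [inf_comm])
      omega
  obtain ⟨e₃, hC⟩ := hA.inf hS hB
  have hCsep := hGFERF (A ⊓ B) ⟨e₃, Nat.cast_nonneg _, hC.isQuasiconvex⟩
  rw [separableSubset_iff]
  intro g hg
  set N := wordLength S g + 2 * (k + 2 * (2 * D + 1)) + 1 with hNdef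
  obtain ⟨K, hK, hCK, hKN⟩ := exists_finiteIndex_of_separable hCsep (finite_wordLength_le hS N)
  have hN : ∀ x, x ∈ A ⊓ K ∨ x ∈ B ⊓ K → x ∉ A ⊓ B → N ≤ wordLength S x := by
    intro x hx hxC
    by_contra! hlt
    exact hxC (hKN x hlt.le (hx.elim And.right And.right))
  obtain ⟨e₄, hP⟩ := hA.inf_finiteIndex hS K
  obtain ⟨e₅, hQ⟩ := hB.inf_finiteIndex hS K
  have hABP : A ⊓ B ≤ A ⊓ K := le_inf inf_le_left hCK
  have hABQ : A ⊓ B ≤ B ⊓ K := le_inf inf_le_right hCK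
  have hH := natQuasiconvex_sup hS hD inf_le_left inf_le_left hABP hABQ hk hN (by omega)
    (hP.mono (le_max_left e₄ e₅)) (hQ.mono (le_max_right e₄ e₅))
  have hHsep := hGFERF _ ⟨_, Nat.cast_nonneg _, hH.isQuasiconvex⟩
  obtain ⟨F₁, hF₁, hF₁A, hAF⟩ := exists_finite_transversal A K
  obtain ⟨F₂, hF₂, hF₂B, hBF⟩ := exists_finite_transversal B K
  obtain ⟨M, hM, hM', h⟩ := exists_normal_finiteIndex_of_finite (hF₁.prod hF₂)
    (fun f N => ∀ m ∈ N, f.1⁻¹ * g * f.2 * m ∉ (A ⊓ K) ⊔ (B ⊓ K))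
    (fun f M N hMN h m hm => h m (hMN hm)) (by
      rintro ⟨f₁, f₂⟩ ⟨h₁, h₂⟩
      refine separableSubset_iff.1 hHsep _ fun hmem => hg ?_
      have hprod : f₁ * (f₁⁻¹ * g * f₂) * f₂⁻¹ = g := by group
      have := mem_mul_of_short hS hD inf_le_left inf_le_left hABP hABQ hk hN
        (hF₁A h₁) hmem (B.inv_mem (hF₂B h₂)) (by rw [hprod]; omega)
      rwa [hprod] at this)
  refine ⟨M, hM, hM', ?_⟩
  rintro m hm ⟨a, ha, b, hb, hab⟩
  obtain ⟨f₁, hf₁, h₁⟩ := hAF a⁻¹ (A.inv_mem ha)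
  obtain ⟨f₂, hf₂, h₂⟩ := hBF b hb
  refine h (f₁, f₂) ⟨hf₁, hf₂⟩ (f₂⁻¹ * m * f₂) (by simpa using hM.conj_mem m hm f₂⁻¹) ?_
  have hsplit : f₁⁻¹ * g * f₂ * (f₂⁻¹ * m * f₂) = (a⁻¹ * f₁)⁻¹ * (b * f₂) := by
    calc f₁⁻¹ * g * f₂ * (f₂⁻¹ * m * f₂) = f₁⁻¹ * (g * m) * f₂ := by group
      _ = (a⁻¹ * f₁)⁻¹ * (b * f₂) := by rw [← show a * b = g * m from hab]; group
  rw [hsplit]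
  exact Subgroup.mul_mem _ (Subgroup.inv_mem _ (Subgroup.mem_sup_left h₁))
    (Subgroup.mem_sup_right h₂)
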